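/- Let l₁, l₂, l₃, l₄, l₅ be five distinct lines in Pic S₈ with lᵢ·lⱼ = 1 for all i ≠ j. If {l₁, l₂, l₃, l₄} forms a cornered A₃⁸(1)-polytope, then the A₃⁸(1)-polytope {l₁, l₂, l₃, l₅} is uncornered. -/

import Mathlib

/-!
Picard lattice of the degree 1 del Pezzo surface S₈:
Pic S₈ = ℤh ⊕ ℤe₁ ⊕ ⋯ ⊕ ℤe₈ ≅ ℤ⁹, with intersection pairing
h·h = 1, h·eᵢ = 0, eᵢ·eⱼ = −δᵢⱼ, and canonical class K = −3h + e₁ + ⋯ + e₈.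
-/

namespace DelPezzo

/-- The Picard lattice `Pic S₈ ≅ ℤ⁹`; coordinate `0` is the `h`-coordinate and
coordinates `1,…,8` are the `e₁,…,e₈`-coordinates. -/
abbrev Pic : Type := Fin 9 → ℤ

/-- The intersection pairing on `Pic S₈` (signature `(1,-8)`). -/
def inter (x y : Pic) : ℤ := x 0 * y 0 - ∑ i : Fin 8, x i.succ * y i.succ

/-- The canonical class `K = -3h + e₁ + ⋯ + e₈`. -/
def K : Pic := fun i => if i = 0 then -3 else 1

/-- A line: a class `l` with `l·l = -1` and `l·K = -1`. -/
def IsLine (l : Pic) : Prop := inter l l = -1 ∧ inter l K = -1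

lemma inter_comm (x y : Pic) : inter x y = inter y x := by
  simp only [inter, mul_comm]

lemma inter_add_left (x y z : Pic) : inter (x + y) z = inter x z + inter y z := by
  simp only [inter, Pi.add_apply, add_mul, Finset.sum_add_distrib]
  ring

lemma inter_smul_left (c : ℤ) (x y : Pic) : inter (c • x) y = c * inter x y := by
  simp only [inter, Pi.smul_apply, smul_eq_mul, mul_assoc, ← Finset.mul_sum]
  ring

lemma inter_sub_left (x y z : Pic) : inter (x - y) z = inter x z - inter y z := by
  simp only [inter, Pi.sub_apply, sub_mul, Finset.sum_sub_distrib]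
  ring

lemma inter_add_right (x y z : Pic) : inter x (y + z) = inter x y + inter x z := by
  rw [inter_comm, inter_add_left, inter_comm y, inter_comm z]

lemma inter_smul_right (c : ℤ) (x y : Pic) : inter x (c • y) = c * inter x y := by
  rw [inter_comm, inter_smul_left, inter_comm y]

lemma inter_sub_right (x y z : Pic) : inter x (y - z) = inter x y - inter x z := by
  rw [inter_comm, inter_sub_left, inter_comm y, inter_comm z]

lemma inter_K_K : inter K K = 1 := by decide

/-- The intersection pairing is anisotropic on the orthogonal complement of `K`. -/
lemma eq_zero_of_inter_self_eq_zero {v : Pic} (hK : inter v K = 0) (hv : inter v v = 0) :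
    v = 0 := by
  have hsum : ∑ i : Fin 8, v i.succ = -3 * v 0 := by
    simp only [inter, K, Fin.succ_ne_zero, if_true, if_false, mul_one] at hK
    linarith
  have hsq : ∑ i : Fin 8, v i.succ ^ 2 = v 0 ^ 2 := by
    simp only [inter, ← sq] at hv
    linarith
  have hcs := sq_sum_le_card_mul_sum_sq (s := Finset.univ) (f := fun i : Fin 8 => v i.succ)
  rw [hsum, hsq, Finset.card_univ, Fintype.card_fin] at hcs
  push_cast at hcs
  have h0 : v 0 = 0 := by nlinarith [sq_nonneg (v 0)]
  rw [h0, zero_pow two_ne_zero, Finset.sum_eq_zero_iff_of_nonneg fun i _ => sq_nonneg _] at hsq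
  ext i
  refine Fin.cases h0 (fun j => ?_) i
  simpa using hsq j (Finset.mem_univ j)

/-- A line disjoint from four pairwise `1`-intersecting lines is determined by their center. -/
lemma two_smul_corner {a b c d m : Pic} (ha : IsLine a) (hb : IsLine b) (hc : IsLine c)
    (hd : IsLine d) (hm : IsLine m) (hab : inter a b = 1) (hac : inter a c = 1)
    (had : inter a d = 1) (hbc : inter b c = 1) (hbd : inter b d = 1) (hcd : inter c d = 1)
    (hma : inter m a = 0) (hmb : inter m b = 0) (hmc : inter m c = 0) (hmd : inter m d = 0) :
    (2 : ℤ) • m = a + b + c + d + (2 : ℤ) • K := by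
  rw [← sub_eq_zero]
  apply eq_zero_of_inter_self_eq_zero <;>
    simp only [inter_add_left, inter_sub_left, inter_smul_left, inter_add_right, inter_sub_right,
      inter_smul_right, inter_comm K a, inter_comm K b, inter_comm K c, inter_comm K d,
      inter_comm K m, inter_comm a m, inter_comm b m, inter_comm c m, inter_comm d m,
      inter_comm b a, inter_comm c a, inter_comm d a, inter_comm c b, inter_comm d b,
      inter_comm d c, ha.1, ha.2, hb.1, hb.2, hc.1, hc.2, hd.1, hd.2, hm.1, hm.2, inter_K_K,
      hab, hac, had, hbc, hbd, hcd, hma, hmb, hmc, hmd] <;>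
    norm_num

theorem cornered_then_swap_uncornered (l₁ l₂ l₃ l₄ l₅ : Pic)
    (h₁ : IsLine l₁) (h₂ : IsLine l₂) (h₃ : IsLine l₃) (h₄ : IsLine l₄) (h₅ : IsLine l₅)
    (hne : l₁ ≠ l₂ ∧ l₁ ≠ l₃ ∧ l₁ ≠ l₄ ∧ l₁ ≠ l₅ ∧ l₂ ≠ l₃ ∧ l₂ ≠ l₄ ∧ l₂ ≠ l₅ ∧
      l₃ ≠ l₄ ∧ l₃ ≠ l₅ ∧ l₄ ≠ l₅)
    (h₁₂ : inter l₁ l₂ = 1) (h₁₃ : inter l₁ l₃ = 1) (h₁₄ : inter l₁ l₄ = 1)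
    (h₁₅ : inter l₁ l₅ = 1) (h₂₃ : inter l₂ l₃ = 1) (h₂₄ : inter l₂ l₄ = 1)
    (h₂₅ : inter l₂ l₅ = 1) (h₃₄ : inter l₃ l₄ = 1) (h₃₅ : inter l₃ l₅ = 1)
    (h₄₅ : inter l₄ l₅ = 1)
    (hcor : ∃ m : Pic, IsLine m ∧
      inter m l₁ = 0 ∧ inter m l₂ = 0 ∧ inter m l₃ = 0 ∧ inter m l₄ = 0) :
    ¬ ∃ m : Pic, IsLine m ∧
      inter m l₁ = 0 ∧ inter m l₂ = 0 ∧ inter m l₃ = 0 ∧ inter m l₅ = 0 := by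
  obtain ⟨m, hm, hm₁, hm₂, hm₃, hm₄⟩ := hcor
  rintro ⟨n, hn, hn₁, hn₂, hn₃, hn₅⟩
  have hcm := two_smul_corner h₁ h₂ h₃ h₄ hm h₁₂ h₁₃ h₁₄ h₂₃ h₂₄ h₃₄ hm₁ hm₂ hm₃ hm₄
  have hcn := two_smul_corner h₁ h₂ h₃ h₅ hn h₁₂ h₁₃ h₁₅ h₂₃ h₂₅ h₃₅ hn₁ hn₂ hn₃ hn₅
  have hmn := congrArg (inter n) hcm
  have hn₄ := congrArg (inter l₄) hcn
  simp only [inter_add_right, inter_smul_right, hn₁, hn₂, hn₃, hn.2] at hmn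
  simp only [inter_add_right, inter_smul_right, inter_comm l₄ l₁, inter_comm l₄ l₂,
    inter_comm l₄ l₃, inter_comm l₄ n, h₁₄, h₂₄, h₃₄, h₄₅, h₄.2] at hn₄
  omega

end DelPezzo
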